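/- arXiv:2410.19992 — 4 statements merged into one kernel-verified Lean document; each statement's English description precedes it below -/
import Mathlib

section
/- For every nonzero fractional ideal 𝔞 of O_K, every w ∈ ℂ and every τ in the upper half-plane ℍ, the family a ↦ exp(2πi(N(𝔞)⁻¹ N(a) τ + a w)), indexed by the elements a of 𝔞, is absolutely summable; hence the intrinsic theta function ϑ_𝔞(w,τ) is well defined on ℂ × ℍ. -/
open Complex NumberField UpperHalfPlane
open scoped nonZeroDivisors

/-- A number field of degree two with a non-real embedding `σ` has only one infinite place. -/
theorem infinitePlace_eq_mk_of_finrank_eq_two {K : Type*} [Field K] [NumberField K]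
    (hdeg : Module.finrank ℚ K = 2) {σ : K →+* ℂ} (hσ : ¬ ComplexEmbedding.IsReal σ)
    (v : InfinitePlace K) : v = InfinitePlace.mk σ := by
  classical
  have hv : (InfinitePlace.mk σ).IsComplex := InfinitePlace.isComplex_mk_iff.mpr hσ
  have hpos : 0 < InfinitePlace.nrComplexPlaces K := Fintype.card_pos_iff.mpr ⟨⟨_, hv⟩⟩
  have hrank := InfinitePlace.card_add_two_mul_card_eq_rank K
  have hcard := InfinitePlace.card_eq_nrRealPlaces_add_nrComplexPlaces (K := K)
  have : Subsingleton (InfinitePlace K) := Fintype.card_le_one_iff_subsingleton.mp (by omega)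
  exact Subsingleton.elim _ _

open scoped Classical in
theorem norm_mixedEmbedding_of_finrank_eq_two {K : Type*} [Field K] [NumberField K]
    (hdeg : Module.finrank ℚ K = 2) {σ : K →+* ℂ} (hσ : ¬ ComplexEmbedding.IsReal σ) (x : K) :
    ‖mixedEmbedding K x‖ = ‖σ x‖ := by
  rw [mixedEmbedding.norm_eq_sup'_normAtPlace]
  simp [mixedEmbedding.normAtPlace_apply, infinitePlace_eq_mk_of_finrank_eq_two hdeg hσ,
    InfinitePlace.apply]

open scoped Classical in
theorem summable_norm_inv_pow_three_fractionalIdeal {K : Type*} [Field K] [NumberField K]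
    (hdeg : Module.finrank ℚ K = 2) {σ : K →+* ℂ} (hσ : ¬ ComplexEmbedding.IsReal σ)
    (I : (FractionalIdeal (𝓞 K)⁰ K)ˣ) :
    Summable fun a : ((I : FractionalIdeal (𝓞 K)⁰ K) : Submodule (𝓞 K) K) => ‖σ a‖⁻¹ ^ 3 := by
  have hrank : Module.finrank ℤ (mixedEmbedding.idealLattice K I) = 2 := by
    rw [ZLattice.rank ℝ (mixedEmbedding.idealLattice K I), mixedEmbedding.finrank, hdeg]
  have hsum := ZLattice.summable_norm_pow_inv (mixedEmbedding.idealLattice K I) 3 (by omega)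
  let f (a : ((I : FractionalIdeal (𝓞 K)⁰ K) : Submodule (𝓞 K) K)) :
      mixedEmbedding.idealLattice K I :=
    ⟨mixedEmbedding K a, (mixedEmbedding.mem_idealLattice K I).mpr ⟨a, a.2, rfl⟩⟩
  have hf : Function.Injective f := fun a b h =>
    Subtype.ext (mixedEmbedding_injective K (congrArg Subtype.val h))
  refine (hsum.comp_injective hf).congr fun a => ?_
  simp [f, norm_mixedEmbedding_of_finrank_eq_two hdeg hσ]

theorem exp_neg_mul_sq_add_mul_le {c : ℝ} (hc : 0 < c) (b : ℝ) {r : ℝ} (hr : 0 < r) :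
    Real.exp (-c * r ^ 2 + b * r) ≤ 6 * Real.exp ((b + 1) ^ 2 / (4 * c)) * r⁻¹ ^ 3 := by
  have hcube : r ^ 3 ≤ 6 * Real.exp r := by
    have := Real.pow_div_factorial_le_exp r hr.le 3
    norm_num [Nat.factorial] at this
    linarith
  have hsq : -c * r ^ 2 + b * r + r ≤ (b + 1) ^ 2 / (4 * c) := by
    rw [le_div_iff₀ (by positivity)]
    nlinarith [sq_nonneg (2 * c * r - (b + 1))]
  rw [inv_pow, ← div_eq_mul_inv, le_div_iff₀ (by positivity)]
  calc Real.exp (-c * r ^ 2 + b * r) * r ^ 3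
      ≤ Real.exp (-c * r ^ 2 + b * r) * (6 * Real.exp r) := by gcongr
    _ = 6 * Real.exp (-c * r ^ 2 + b * r + r) := by rw [Real.exp_add _ r]; ring
    _ ≤ _ := by gcongr

theorem norm_exp_theta_term_le (N : ℝ) (z w τ : ℂ) :
    ‖Complex.exp (2 * Real.pi * Complex.I * ((N : ℂ)⁻¹ * (Complex.normSq z : ℂ) * τ + z * w))‖ ≤
      Real.exp (-(2 * Real.pi * N⁻¹ * τ.im) * ‖z‖ ^ 2 + 2 * Real.pi * ‖w‖ * ‖z‖) := by
  have him : -(z * w).im ≤ ‖w‖ * ‖z‖ := by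
    rw [mul_comm ‖w‖, ← norm_mul]
    exact (neg_le_abs _).trans (Complex.abs_im_le_norm _)
  have hre : (2 * Real.pi * Complex.I *
      ((N : ℂ)⁻¹ * (Complex.normSq z : ℂ) * τ + z * w)).re =
      -(2 * Real.pi * N⁻¹ * τ.im) * ‖z‖ ^ 2 + 2 * Real.pi * -(z * w).im := by
    have h1 : (N : ℂ)⁻¹ * (Complex.normSq z : ℂ) * τ + z * w =
        ((N⁻¹ * Complex.normSq z : ℝ) : ℂ) * τ + z * w := by push_cast; rfl
    have h2 (u : ℂ) : (2 * Real.pi * Complex.I * u).re = -(2 * Real.pi * u.im) := by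
      simp [Complex.mul_re]
    rw [h1, h2, Complex.add_im, Complex.im_ofReal_mul, Complex.normSq_eq_norm_sq]
    ring
  rw [Complex.norm_exp, hre, mul_assoc (2 * Real.pi) ‖w‖]
  gcongr

/-- For `K` an imaginary quadratic field (embedded in `ℂ` via `σ`),
a nonzero fractional ideal `𝔞` of `O_K`, `w ∈ ℂ` and `τ ∈ ℍ`, the family
`a ∈ 𝔞 ↦ exp(2πi(N(𝔞)⁻¹ N(a) τ + a w))` is absolutely summable, so the intrinsic
theta function `ϑ_𝔞(w,τ)` is well defined. -/
theorem statement4 (K : Type*) [Field K] [NumberField K]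
    (hdeg : Module.finrank ℚ K = 2)
    (σ : K →+* ℂ) (himag : ∃ x : K, (σ x).im ≠ 0)
    (𝔞 : FractionalIdeal (𝓞 K)⁰ K) (h𝔞 : 𝔞 ≠ 0)
    (w : ℂ) (τ : ℍ) :
    Summable (fun a : (𝔞 : Submodule (𝓞 K) K) =>
      Complex.exp (2 * Real.pi * Complex.I *
        (((FractionalIdeal.absNorm 𝔞 : ℚ) : ℂ)⁻¹ * (Complex.normSq (σ a) : ℂ) * (τ : ℂ) +
          σ a * w))) := by
  have hσ : ¬ ComplexEmbedding.IsReal σ := fun h => by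
    obtain ⟨x, hx⟩ := himag
    exact hx (Complex.conj_eq_iff_im.mp (RingHom.congr_fun h x))
  have hN : (0 : ℝ) < (FractionalIdeal.absNorm 𝔞 : ℚ) := by
    exact_mod_cast (FractionalIdeal.absNorm_nonneg 𝔞).lt_of_ne'
      (mt FractionalIdeal.absNorm_eq_zero_iff.mp h𝔞)
  have hc : 0 < 2 * Real.pi * ((FractionalIdeal.absNorm 𝔞 : ℚ) : ℝ)⁻¹ * (τ : ℂ).im := by
    have := τ.im_pos
    positivity
  refine Summable.of_norm_bounded_eventually
    ((summable_norm_inv_pow_three_fractionalIdeal hdeg hσ (Units.mk0 𝔞 h𝔞)).mul_left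
      (6 * Real.exp ((2 * Real.pi * ‖w‖ + 1) ^ 2 /
        (4 * (2 * Real.pi * ((FractionalIdeal.absNorm 𝔞 : ℚ) : ℝ)⁻¹ * (τ : ℂ).im))))) ?_
  filter_upwards [(Set.finite_singleton 0).compl_mem_cofinite] with a ha
  have hpos : 0 < ‖σ a‖ := by simpa using ha
  simpa using (norm_exp_theta_term_le (FractionalIdeal.absNorm 𝔞 : ℚ) (σ a) w τ).trans
    (exp_neg_mul_sq_add_mul_le hc (2 * Real.pi * ‖w‖) hpos)
end

section
/- Let D be the discriminant of the imaginary quadratic field K. For every γ = (a b; c d) ∈ SL₂(ℤ) with a ≡ d ≡ 1 (mod D) and c ≡ 0 (mod D), every nonzero fractional ideal 𝔞 of O_K, every τ in the upper half-plane ℍ and every w ∈ ℂ, one has ϑ_𝔞(w/(cτ+d), (aτ+b)/(cτ+d)) = (cτ+d) · ϑ_𝔞(w,τ). (This is the transformation law ϑ_𝔞(j(γ,τ)⁻¹w, γτ) = ω_{K/ℚ}(γ) j(γ,τ) ϑ_𝔞(w,τ) for γ ∈ Γ₁(D), the quadratic character ω_{K/ℚ} being trivial on Γ₁(D).) -/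
open Complex NumberField UpperHalfPlane
open scoped nonZeroDivisors MatrixGroups

/-- The intrinsic theta function
`ϑ_𝔞(w,τ) = Σ_{a ∈ 𝔞} exp(2πi(N(𝔞)⁻¹ N(a) τ + a w))`, where `N(𝔞)` is the absolute
norm of the fractional ideal `𝔞` and `N(a) = a·conj(a) = |σ(a)|²`. -/
noncomputable def intrinsicTheta (K : Type*) [Field K] [NumberField K] (σ : K →+* ℂ)
    (𝔞 : FractionalIdeal (𝓞 K)⁰ K) (w : ℂ) (τ : ℍ) : ℂ :=
  ∑' a : (𝔞 : Submodule (𝓞 K) K),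
    Complex.exp (2 * Real.pi * Complex.I *
      (((FractionalIdeal.absNorm 𝔞 : ℚ) : ℂ)⁻¹ * (Complex.normSq (σ a) : ℂ) * (τ : ℂ) +
        σ a * w))

/-- The two-variable theta series `∑ exp(2πi(τ(Ax² + Bxy + Cy²) + αx + βy))` of a binary
quadratic form. -/
noncomputable def binaryTheta (A B C : ℤ) (α β τ : ℂ) : ℂ :=
  ∑' x : ℤ × ℤ, cexp (2 * Real.pi * Complex.I *
    (τ * (A * x.1 ^ 2 + B * x.1 * x.2 + C * x.2 ^ 2) + α * x.1 + β * x.2))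

lemma summable_exp_quadratic {T : ℂ} (hT : 0 < T.im) (z : ℂ) :
    Summable fun n : ℤ ↦ cexp (2 * Real.pi * Complex.I * (T / 2 * n ^ 2 + z * n)) := by
  refine ((summable_jacobiTheta₂_term_iff z T).2 hT).congr fun n ↦ ?_
  rw [jacobiTheta₂_term]
  congr 1
  ring

lemma im_neg_one_div_pos {T : ℂ} (hT : 0 < T.im) : 0 < (-1 / T).im := by
  have h0 : T ≠ 0 := fun h ↦ by simp [h] at hT
  rw [neg_div, one_div, neg_im, inv_im, neg_div, neg_neg]
  exact div_pos hT (normSq_pos.2 h0)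

lemma summable_exp_shifted_quadratic {T : ℂ} (hT : 0 < T.im) (z : ℂ) :
    Summable fun n : ℤ ↦ cexp (2 * Real.pi * Complex.I * (-(n + z) ^ 2 / (2 * T))) := by
  have h0 : T ≠ 0 := fun h ↦ by simp [h] at hT
  refine ((summable_exp_quadratic (im_neg_one_div_pos hT) (-z / T)).mul_left
    (cexp (2 * Real.pi * Complex.I * (-z ^ 2 / (2 * T))))).congr fun n ↦ ?_
  rw [← Complex.exp_add]
  congr 1
  field_simp
  ring

lemma tsum_exp_quadratic (T z : ℂ) :
    ∑' n : ℤ, cexp (2 * Real.pi * Complex.I * (T / 2 * n ^ 2 + z * n)) =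
      1 / (-Complex.I * T) ^ (1 / 2 : ℂ) * ∑' n : ℤ, cexp (2 * Real.pi * Complex.I * (-(n + z) ^ 2 / (2 * T))) := by
  have h1 : ∑' n : ℤ, cexp (2 * Real.pi * Complex.I * (T / 2 * n ^ 2 + z * n)) = jacobiTheta₂ z T := by
    refine tsum_congr fun n ↦ ?_
    rw [jacobiTheta₂_term]
    congr 1
    ring
  rw [h1, jacobiTheta₂_functional_equation, mul_assoc, ← jacobiTheta₂_neg_left, jacobiTheta₂,
    ← tsum_mul_left]
  congr 1
  refine tsum_congr fun n ↦ ?_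
  rw [jacobiTheta₂_term, ← Complex.exp_add]
  congr 1
  ring

lemma summable_binaryTheta {A B C : ℤ} (hA : 0 < A) (hΔ : 0 < 4 * A * C - B ^ 2) {τ : ℂ}
    (hτ : 0 < τ.im) (α β : ℂ) :
    Summable fun x : ℤ × ℤ ↦ cexp (2 * Real.pi * Complex.I *
      (τ * (A * x.1 ^ 2 + B * x.1 * x.2 + C * x.2 ^ 2) + α * x.1 + β * x.2)) := by
  have hC : 0 < C := by nlinarith [sq_nonneg B]
  set δ : ℝ := ((4 * A * C - B ^ 2 : ℤ) : ℝ) / (4 * (A + C)) with hδ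
  have hA' : (0 : ℝ) < A := by exact_mod_cast hA
  have hC' : (0 : ℝ) < C := by exact_mod_cast hC
  have hδpos : 0 < δ := div_pos (by exact_mod_cast hΔ) (by positivity)
  have hT : 0 < (2 * δ * τ : ℂ).im := by
    have : (2 * δ * τ : ℂ).im = 2 * δ * τ.im := by
      rw [show (2 * δ * τ : ℂ) = ((2 * δ : ℝ) : ℂ) * τ by push_cast; ring, im_ofReal_mul]
    rw [this]
    positivity
  have key (x y : ℝ) : δ * (x ^ 2 + y ^ 2) ≤ A * x ^ 2 + B * x * y + C * y ^ 2 := by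
    rw [hδ, div_mul_eq_mul_div, div_le_iff₀ (by positivity)]
    push_cast
    nlinarith [sq_nonneg (2 * A * x + B * y), sq_nonneg (2 * C * y + B * x)]
  refine (((summable_exp_quadratic hT α).norm.mul_of_nonneg (summable_exp_quadratic hT β).norm
    (fun _ ↦ norm_nonneg _) (fun _ ↦ norm_nonneg _))).of_norm_bounded fun x ↦ ?_
  have hre (z : ℂ) : (2 * Real.pi * Complex.I * z).re = -(2 * Real.pi * z.im) := by
    rw [show 2 * Real.pi * Complex.I * z = ((2 * Real.pi : ℝ) : ℂ) * (Complex.I * z) by push_cast; ring,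
      re_ofReal_mul, I_mul_re]
    ring
  rw [norm_exp, norm_exp, norm_exp, ← Real.exp_add, Real.exp_le_exp, hre, hre, hre]
  have e1 : (τ * (A * x.1 ^ 2 + B * x.1 * x.2 + C * x.2 ^ 2) + α * x.1 + β * x.2).im
      = τ.im * (A * (x.1 : ℝ) ^ 2 + B * x.1 * x.2 + C * (x.2 : ℝ) ^ 2) + α.im * x.1
        + β.im * x.2 := by
    rw [show τ * (A * x.1 ^ 2 + B * x.1 * x.2 + C * x.2 ^ 2) + α * x.1 + β * x.2 =
      ((A * (x.1 : ℝ) ^ 2 + B * x.1 * x.2 + C * (x.2 : ℝ) ^ 2 : ℝ) : ℂ) * τ +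
        ((x.1 : ℝ) : ℂ) * α + ((x.2 : ℝ) : ℂ) * β by push_cast; ring, add_im, add_im,
      im_ofReal_mul, im_ofReal_mul, im_ofReal_mul]
    ring
  have e2 (n : ℤ) (z : ℂ) : (2 * δ * τ / 2 * n ^ 2 + z * n).im
      = δ * τ.im * (n : ℝ) ^ 2 + z.im * n := by
    rw [show 2 * δ * τ / 2 * n ^ 2 + z * n =
      ((δ * (n : ℝ) ^ 2 : ℝ) : ℂ) * τ + ((n : ℝ) : ℂ) * z by push_cast; ring, add_im,
      im_ofReal_mul, im_ofReal_mul]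
    ring
  rw [e1, e2, e2]
  have h3 := mul_le_mul_of_nonneg_left (key x.1 x.2)
    (mul_nonneg (mul_nonneg zero_le_two Real.pi_pos.le) hτ.le)
  linarith

lemma cpow_half_mul_cpow_half {T : ℂ} (hT : 0 < T.im) {r s : ℝ} (hr : 0 < r) (hs : 0 < s) :
    (-Complex.I * (r * T)) ^ (1 / 2 : ℂ) * (-Complex.I * (s * T)) ^ (1 / 2 : ℂ) =
      ((Real.sqrt (r * s) : ℝ) : ℂ) * (-Complex.I * T) := by
  have h0 : -Complex.I * T ≠ 0 := by
    refine mul_ne_zero (neg_ne_zero.2 I_ne_zero) fun h ↦ by simp [h] at hT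
  have e (t : ℝ) (ht : 0 < t) :
      (-Complex.I * (t * T)) ^ (1 / 2 : ℂ) = ((Real.sqrt t : ℝ) : ℂ) * (-Complex.I * T) ^ (1 / 2 : ℂ) := by
    have ht0 : (t : ℂ) ≠ 0 := by exact_mod_cast ht.ne'
    rw [show -Complex.I * (t * T) = (t : ℂ) * (-Complex.I * T) by ring, Real.sqrt_eq_rpow,
      ofReal_cpow ht.le, cpow_def_of_ne_zero (mul_ne_zero ht0 h0), log_ofReal_mul ht h0, add_mul,
      Complex.exp_add, ofReal_log ht.le, ← cpow_def_of_ne_zero ht0, ← cpow_def_of_ne_zero h0]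
    norm_num
  rw [e r hr, e s hs, Real.sqrt_mul hr.le, mul_mul_mul_comm, ← cpow_add _ _ h0]
  norm_num

lemma summable_binaryTheta_dual {A B C : ℤ} (hA : 0 < A) (hΔ : 0 < 4 * A * C - B ^ 2) {τ : ℂ}
    (hτ : 0 < τ.im) (α β : ℂ) :
    Summable fun k : ℤ × ℤ ↦ cexp (2 * Real.pi * Complex.I *
      (-(C * (k.1 + α) ^ 2 - B * (k.1 + α) * (k.2 + β) + A * (k.2 + β) ^ 2) /
        ((4 * A * C - B ^ 2) * τ))) := by
  have hτ0 : τ ≠ 0 := fun h ↦ by simp [h] at hτ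
  have hC : 0 < C := by nlinarith [sq_nonneg B]
  have hΔ' : (0 : ℝ) < 4 * A * C - B ^ 2 := by exact_mod_cast hΔ
  have hΔ0 : (4 * A * C - B ^ 2 : ℂ) ≠ 0 := by exact_mod_cast hΔ.ne'
  have hT : 0 < (-1 / (((4 * A * C - B ^ 2 : ℝ) : ℂ) * τ)).im :=
    im_neg_one_div_pos (by rw [im_ofReal_mul]; positivity)
  have h := summable_binaryTheta (A := C) (B := -B) (C := A) hC (by linarith) hT
    (-(2 * C * α - B * β) / ((4 * A * C - B ^ 2) * τ))
    (-(2 * A * β - B * α) / ((4 * A * C - B ^ 2) * τ))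
  refine (h.mul_left (cexp (2 * Real.pi * Complex.I * (-(C * α ^ 2 - B * α * β + A * β ^ 2) /
      ((4 * A * C - B ^ 2) * τ))))).congr fun k ↦ ?_
  rw [← Complex.exp_add]
  congr 1
  push_cast
  field_simp
  ring

set_option maxHeartbeats 1000000 in
lemma binaryTheta_poisson {A B C : ℤ} (hA : 0 < A) (hΔ : 0 < 4 * A * C - B ^ 2) {τ : ℂ}
    (hτ : 0 < τ.im) (α β : ℂ) :
    binaryTheta A B C α β τ =
      Complex.I / (((Real.sqrt (4 * A * C - B ^ 2) : ℝ) : ℂ) * τ) *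
        ∑' k : ℤ × ℤ, cexp (2 * Real.pi * Complex.I *
          (-(C * (k.1 + α) ^ 2 - B * (k.1 + α) * (k.2 + β) + A * (k.2 + β) ^ 2) /
            ((4 * A * C - B ^ 2) * τ))) := by
  have hτ0 : τ ≠ 0 := fun h ↦ by simp [h] at hτ
  have hA0 : (A : ℂ) ≠ 0 := by exact_mod_cast hA.ne'
  have hA' : (0 : ℝ) < A := by exact_mod_cast hA
  have hC : 0 < C := by nlinarith [sq_nonneg B]
  have hΔ' : (0 : ℝ) < 4 * A * C - B ^ 2 := by exact_mod_cast hΔ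
  have hΔ0 : (4 * A * C - B ^ 2 : ℂ) ≠ 0 := by exact_mod_cast hΔ.ne'
  set r : ℝ := 2 * A with hr
  set s : ℝ := (4 * A * C - B ^ 2) / (2 * A) with hs
  have hrpos : 0 < r := by positivity
  have hspos : 0 < s := div_pos hΔ' hrpos
  have hrC : (r : ℂ) = 2 * A := by rw [hr]; push_cast; ring
  have hsC : (s : ℂ) = (4 * A * C - B ^ 2) / (2 * A) := by rw [hs]; push_cast; ring
  have hrT : 0 < ((r : ℂ) * τ).im := by rw [im_ofReal_mul]; positivity
  have hsT : 0 < ((s : ℂ) * τ).im := by rw [im_ofReal_mul]; positivity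
  let G (y m : ℤ) : ℂ := cexp (2 * Real.pi * Complex.I * (-(m + α) ^ 2 / (2 * (r * τ)))) *
    cexp (2 * Real.pi * Complex.I * (s * τ / 2 * y ^ 2 + (β - B * (m + α) / (2 * A)) * y))
  have hG : Summable fun q : ℤ × ℤ ↦ G q.1 q.2 := by
    refine ((((summable_exp_quadratic hsT (β - B * α / (2 * A))).norm.mul_of_nonneg
      (summable_exp_shifted_quadratic hrT α).norm
      (fun _ ↦ norm_nonneg _) (fun _ ↦ norm_nonneg _)))).of_norm_bounded fun q ↦ le_of_eq ?_
    have : G q.1 q.2 = cexp (2 * Real.pi * Complex.I * (-(q.2 + α) ^ 2 / (2 * (r * τ)))) *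
        cexp (2 * Real.pi * Complex.I * (s * τ / 2 * q.1 ^ 2 + (β - B * α / (2 * A)) * q.1)) *
        cexp (((-(2 * Real.pi * B * q.2 * q.1 / (2 * A)) : ℝ) : ℂ) * Complex.I) := by
      simp only [G]
      rw [← Complex.exp_add, ← Complex.exp_add, ← Complex.exp_add]
      congr 1
      push_cast
      ring
    rw [this, norm_mul, norm_mul, norm_exp_ofReal_mul_I, mul_one, mul_comm]
  have hF := summable_binaryTheta hA hΔ hτ α β
  have hH := summable_binaryTheta_dual hA hΔ hτ α β
  have inner (y : ℤ) : ∑' x : ℤ, cexp (2 * Real.pi * Complex.I *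
      (τ * (A * x ^ 2 + B * x * y + C * y ^ 2) + α * x + β * y)) =
        1 / (-Complex.I * (r * τ)) ^ (1 / 2 : ℂ) * ∑' m : ℤ, G y m := by
    have h := tsum_exp_quadratic (r * τ) (α + B * τ * y)
    calc _ = cexp (2 * Real.pi * Complex.I * (τ * C * y ^ 2 + β * y)) * ∑' n : ℤ, cexp (2 * Real.pi * Complex.I *
          (r * τ / 2 * n ^ 2 + (α + B * τ * y) * n)) := by
          rw [← tsum_mul_left]
          refine tsum_congr fun x ↦ ?_
          rw [← Complex.exp_add, hrC]
          congr 1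
          ring
      _ = _ := by
          rw [h, mul_left_comm, ← tsum_mul_left]
          congr 1
          refine tsum_congr fun m ↦ ?_
          simp only [G]
          rw [← Complex.exp_add, ← Complex.exp_add, hrC, hsC]
          congr 1
          field_simp
          ring
  have outer (m : ℤ) : ∑' y : ℤ, G y m = 1 / (-Complex.I * (s * τ)) ^ (1 / 2 : ℂ) *
      ∑' n : ℤ, cexp (2 * Real.pi * Complex.I *
      (-(C * (m + α) ^ 2 - B * (m + α) * (n + β) + A * (n + β) ^ 2) /
        ((4 * A * C - B ^ 2) * τ))) := by
    simp only [G]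
    rw [tsum_mul_left, tsum_exp_quadratic, mul_left_comm, ← tsum_mul_left]
    congr 1
    refine tsum_congr fun n ↦ ?_
    obtain ⟨E, hE⟩ : ∃ E : ℂ, E = 4 * A * C - B ^ 2 := ⟨_, rfl⟩
    rw [← Complex.exp_add, hrC, hsC]
    rw [← hE] at hΔ0 ⊢
    congr 1
    field_simp
    rw [hE]
    ring
  have hF' := (Equiv.prodComm ℤ ℤ).summable_iff.2 hF
  simp only [Function.comp_def] at hF'
  rw [binaryTheta, ← (Equiv.prodComm ℤ ℤ).tsum_eq, hF'.tsum_prod]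
  simp only [Equiv.prodComm_apply, Prod.fst_swap, Prod.snd_swap]
  simp_rw [inner]
  rw [tsum_mul_left, ← hG.tsum_comm]
  simp_rw [outer]
  rw [tsum_mul_left, ← hH.tsum_prod, ← mul_assoc, div_mul_div_comm,
    cpow_half_mul_cpow_half hτ hrpos hspos]
  congr 1
  rw [show r * s = 4 * A * C - B ^ 2 by rw [hr, hs]; field_simp]
  have : (((Real.sqrt (4 * A * C - B ^ 2) : ℝ) : ℂ)) ≠ 0 := by
    exact_mod_cast (Real.sqrt_pos.2 hΔ').ne'
  rw [div_eq_div_iff (by simp [this, hτ0]) (by simp [this, hτ0])]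
  linear_combination (τ * ((Real.sqrt (4 * A * C - B ^ 2) : ℝ) : ℂ)) * I_sq

lemma sum_addChar_bilinear {F : Type*} [Field F] [Fintype F] [DecidableEq F]
    {ψ : AddChar F ℂ} (hψ : ψ.IsPrimitive) {a : F} (ha : a ≠ 0) (l m : F) :
    ∑ q : F × F, ψ (a * q.1 * q.2 + l * q.1 + m * q.2) = Fintype.card F * ψ (-(l * m) / a) := by
  have inner (u : F) : ∑ v : F, ψ (a * u * v + l * u + m * v) =
      if u = -m / a then ψ (l * u) * Fintype.card F else 0 := by
    have h : a * u + m = 0 ↔ u = -m / a := by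
      rw [eq_div_iff ha, mul_comm u, ← eq_neg_iff_add_eq_zero]
    calc _ = ψ (l * u) * ∑ v : F, ψ (v * (a * u + m)) := by
          rw [Finset.mul_sum]
          refine Finset.sum_congr rfl fun v _ ↦ ?_
          rw [← AddChar.map_add_eq_mul]
          congr 1
          ring
      _ = _ := by
          rw [AddChar.sum_mulShift _ hψ]
          simp only [h]
          split_ifs <;> simp
  rw [Fintype.sum_prod_type]
  simp only [inner, Finset.sum_ite_eq', Finset.mem_univ, if_true]
  rw [mul_comm]
  congr 2
  ring

lemma sum_addChar_binaryForm {F : Type*} [Field F] [Fintype F] [DecidableEq F]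
    {ψ : AddChar F ℂ} (hψ : ψ.IsPrimitive) {A B C b e s : F} (h2 : (2 : F) ≠ 0) (hA : A ≠ 0)
    (hs : s ^ 2 = -(4 * A * C - B ^ 2)) (hbe : b * (4 * A * C - B ^ 2) * e = -1) (x y : F) :
    ∑ k : F × F, ψ (e * (C * k.1 ^ 2 - B * k.1 * k.2 + A * k.2 ^ 2) + k.1 * x + k.2 * y) =
      Fintype.card F * ψ (b * (A * x ^ 2 + B * x * y + C * y ^ 2)) := by
  have he : e ≠ 0 := fun h ↦ by simp [h] at hbe
  have hb : b ≠ 0 := fun h ↦ by simp [h] at hbe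
  have hs2 : b * s ^ 2 * e = 1 := by rw [hs]; linear_combination -hbe
  have hs0 : s ≠ 0 := fun h ↦ by simp [h] at hs2
  have h4 : (4 : F) ≠ 0 := by
    rw [show (4 : F) = 2 * 2 by norm_num]; exact mul_ne_zero h2 h2
  let φ : F × F ≃ F × F :=
    { toFun := fun q ↦ ((q.2 - q.1) / (2 * s), (q.1 + (B + s) * ((q.2 - q.1) / (2 * s))) / (2 * A))
      invFun := fun k ↦ (2 * A * k.2 - (B + s) * k.1, 2 * A * k.2 - (B - s) * k.1)
      left_inv := fun q ↦ by
        ext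
        · field_simp
          ring
        · field_simp
          ring
      right_inv := fun k ↦ by
        ext
        · field_simp
          ring
        · field_simp
          ring }
  have ha : e / (4 * A) ≠ 0 := div_ne_zero he (mul_ne_zero h4 hA)
  have hC : C = (B ^ 2 - s ^ 2) / (4 * A) := by
    field_simp
    linear_combination hs
  have hb' : b = 1 / (s ^ 2 * e) := by
    field_simp
    linear_combination hs2
  rw [← φ.sum_comp]
  have key := sum_addChar_bilinear hψ ha (-x / (2 * s) + y * (s - B) / (4 * A * s))
    (x / (2 * s) + y * (B + s) / (4 * A * s))
  rw [show b * (A * x ^ 2 + B * x * y + C * y ^ 2) = -((-x / (2 * s) + y * (s - B) / (4 * A * s)) *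
    (x / (2 * s) + y * (B + s) / (4 * A * s))) / (e / (4 * A)) by
      rw [hb', hC]
      field_simp
      ring, ← key]
  refine Finset.sum_congr rfl fun q _ ↦ ?_
  congr 1
  simp only [φ, Equiv.coe_fn_mk]
  rw [hC]
  field_simp
  ring

lemma isSquare_neg_of_prime_eq_one_mod {n p : ℕ} [Fact p.Prime] (hp2 : p ≠ 2)
    (hn : n % 4 = 0 ∨ n % 4 = 3) (hpn : (n : ℤ) ∣ p - 1) : IsSquare (-(n : ZMod p)) := by
  have hp := (Fact.out : p.Prime)
  have hodd : Odd p := hp.odd_of_ne_two hp2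
  have hn1 : n ≠ 1 := by rintro rfl; omega
  have hmod : p % n = 1 % n := by
    have : (1 : ℤ) ≡ p [ZMOD n] := (Int.modEq_iff_dvd).2 hpn
    exact ((Int.natCast_modEq_iff).1 (by exact_mod_cast this)).symm
  suffices h : ∀ m : ℤ, jacobiSym m p = 1 → IsSquare (m : ZMod p) by
    rcases hn with hn | hn
    · obtain ⟨m, rfl⟩ := Nat.dvd_of_mod_eq_zero hn
      rcases Nat.eq_zero_or_pos m with rfl | hm
      · simp
      have h1 : jacobiSym (-(m : ℤ)) p = 1 := by
        rw [jacobiSym.mod_right _ hodd, Int.natAbs_neg, Int.natAbs_natCast, hmod,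
          Nat.mod_eq_of_lt (by omega), jacobiSym.one_right]
      have h2 := (IsSquare.sq (2 : ZMod p)).mul (h _ h1)
      rwa [show (2 : ZMod p) ^ 2 * ((-(m : ℤ) : ℤ) : ZMod p) = -((4 * m : ℕ) : ZMod p) by
        push_cast
        ring] at h2
    · have hno : Odd n := Nat.odd_iff.2 (by omega)
      have h1 : jacobiSym (-(n : ℤ)) p = 1 := by
        have hr : jacobiSym p n = 1 := by
          rw [jacobiSym.mod_left, ← Int.natCast_mod, hmod, Nat.mod_eq_of_lt (by omega),
            Nat.cast_one, jacobiSym.one_left]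
        rw [jacobiSym.neg _ hodd]
        rcases Nat.odd_mod_four_iff.1 (Nat.odd_iff.1 hodd) with h4 | h4
        · rw [jacobiSym.quadratic_reciprocity_one_mod_four' hno h4, hr,
            ZMod.χ₄_nat_one_mod_four h4, one_mul]
        · rw [jacobiSym.quadratic_reciprocity_three_mod_four hn h4, hr,
            ZMod.χ₄_nat_three_mod_four h4, neg_one_mul, neg_neg]
      simpa using h _ h1
  intro m hm
  rw [← jacobiSym.legendreSym.to_jacobiSym] at hm
  by_cases h0 : (m : ZMod p) = 0
  · simp [h0]
  · exact (legendreSym.eq_one_iff p h0).1 hm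

lemma cexp_two_pi_mul_I_eq {z w : ℂ} (n : ℤ) (h : z = w + n) :
    cexp (2 * Real.pi * Complex.I * z) = cexp (2 * Real.pi * Complex.I * w) := by
  rw [h, mul_add, Complex.exp_add, mul_comm (2 * Real.pi * Complex.I) (n : ℂ),
    Complex.exp_int_mul_two_pi_mul_I, mul_one]

lemma sum_cexp_binaryForm {p : ℕ} [Fact p.Prime] (hp2 : p ≠ 2) {A B C b e : ℤ}
    (hA : (A : ZMod p) ≠ 0) (hs : IsSquare (-((4 * A * C - B ^ 2 : ℤ) : ZMod p)))
    (hbe : (p : ℤ) ∣ b * (4 * A * C - B ^ 2) * e + 1) (x y : ℤ) :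
    ∑ k : Fin p × Fin p, cexp (2 * Real.pi * Complex.I * ((e * (C * (k.1 : ℕ) ^ 2
        - B * (k.1 : ℕ) * (k.2 : ℕ) + A * (k.2 : ℕ) ^ 2) + (k.1 : ℕ) * x + (k.2 : ℕ) * y) / p)) =
      p * cexp (2 * Real.pi * Complex.I * (b * (A * x ^ 2 + B * x * y + C * y ^ 2) / p)) := by
  have hbij : Function.Bijective fun i : Fin p ↦ ((i : ℕ) : ZMod p) := by
    refine (Fintype.bijective_iff_injective_and_card _).2 ⟨fun i j hij ↦ ?_, by simp [ZMod.card]⟩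
    have := (ZMod.natCast_eq_natCast_iff' _ _ _).1 hij
    rw [Nat.mod_eq_of_lt i.2, Nat.mod_eq_of_lt j.2] at this
    exact Fin.ext this
  obtain ⟨s, hs⟩ := hs
  have h2 : (2 : ZMod p) ≠ 0 := by
    have := (Fact.out : p.Prime)
    intro h
    have h' : ((2 : ℕ) : ZMod p) = 0 := by exact_mod_cast h
    rw [ZMod.natCast_eq_zero_iff, Nat.prime_dvd_prime_iff_eq this Nat.prime_two] at h'
    exact hp2 h'
  have hbe' := (ZMod.intCast_zmod_eq_zero_iff_dvd _ p).2 hbe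
  push_cast at hs hbe'
  have key := sum_addChar_binaryForm (ZMod.isPrimitive_stdAddChar p) (A := (A : ZMod p))
    (B := (B : ZMod p)) (C := (C : ZMod p)) (b := (b : ZMod p)) (e := (e : ZMod p)) (s := s) h2 hA
    (by rw [hs, sq]) (eq_neg_of_add_eq_zero_left hbe') x y
  rw [← ((Equiv.ofBijective _ hbij).prodCongr (Equiv.ofBijective _ hbij)).sum_comp, ZMod.card]
    at key
  have h1 : ((b : ZMod p) * (A * x ^ 2 + B * x * y + C * y ^ 2)) =
      ((b * (A * x ^ 2 + B * x * y + C * y ^ 2) : ℤ) : ZMod p) := by push_cast; ring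
  rw [h1, ZMod.stdAddChar_coe] at key
  convert key using 1
  · refine Finset.sum_congr rfl fun k _ ↦ ?_
    have h3 : (e : ZMod p) * (C * ((k.1 : ℕ) : ZMod p) ^ 2
        - B * ((k.1 : ℕ) : ZMod p) * ((k.2 : ℕ) : ZMod p) + A * ((k.2 : ℕ) : ZMod p) ^ 2)
        + ((k.1 : ℕ) : ZMod p) * x + ((k.2 : ℕ) : ZMod p) * y =
        ((e * (C * (k.1 : ℕ) ^ 2 - B * (k.1 : ℕ) * (k.2 : ℕ) + A * (k.2 : ℕ) ^ 2) + (k.1 : ℕ) * x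
          + (k.2 : ℕ) * y : ℤ) : ZMod p) := by push_cast; ring
    simp only [Equiv.prodCongr_apply, Prod.map_fst, Prod.map_snd, Equiv.ofBijective_apply]
    rw [h3, ZMod.stdAddChar_coe]
    congr 1
    push_cast
    ring
  · congr 2
    push_cast
    ring

lemma tsum_int_prod_eq_sum_residues (p : ℕ) [NeZero p] {f : ℤ × ℤ → ℂ} (hf : Summable f) :
    ∑' h, f h = ∑ k : Fin p × Fin p, ∑' m : ℤ × ℤ,
      f (m.1 * p + (k.1 : ℕ), m.2 * p + (k.2 : ℕ)) := by
  let φ : (Fin p × Fin p) × (ℤ × ℤ) ≃ ℤ × ℤ :=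
    (Equiv.prodComm _ _).trans ((Equiv.prodProdProdComm ℤ ℤ (Fin p) (Fin p)).trans
      ((Int.divModEquiv p).prodCongr (Int.divModEquiv p)).symm)
  have h := φ.summable_iff.2 hf
  rw [← φ.tsum_eq, Summable.tsum_prod (by exact h), tsum_fintype]
  rfl

lemma binaryTheta_transform_of_prime {A B C : ℤ} (hA : 0 < A) (hΔ : 0 < 4 * A * C - B ^ 2)
    {α β τ : ℂ} (hτ : 0 < τ.im) (hiso : C * α ^ 2 - B * α * β + A * β ^ 2 = 0)
    {p : ℕ} [Fact p.Prime] (hp2 : p ≠ 2) (hAp : (A : ZMod p) ≠ 0)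
    (hs : IsSquare (-((4 * A * C - B ^ 2 : ℤ) : ZMod p))) {a b c : ℤ}
    (hc : 4 * A * C - B ^ 2 ∣ c) (hdet : a * p - b * c = 1) (hj : (c * τ + p : ℂ) ≠ 0) :
    binaryTheta A B C (α / (c * τ + p)) (β / (c * τ + p)) ((a * τ + b) / (c * τ + p)) =
      (c * τ + p) * binaryTheta A B C α β τ := by
  obtain ⟨e, he⟩ := hc
  have hτ0 : τ ≠ 0 := fun h ↦ by simp [h] at hτ
  have hp0 : (p : ℂ) ≠ 0 := by exact_mod_cast (Fact.out : p.Prime).ne_zero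
  obtain ⟨E, hE⟩ : ∃ E : ℂ, E = 4 * A * C - B ^ 2 := ⟨_, rfl⟩
  have hE0 : E ≠ 0 := by rw [hE]; exact_mod_cast hΔ.ne'
  have hcE : (c : ℂ) = E * e := by rw [hE, he]; push_cast; ring
  have hdetC : (a : ℂ) * p - b * c = 1 := by exact_mod_cast hdet
  obtain ⟨J, hJ⟩ : ∃ J : ℂ, J = c * τ + p := ⟨_, rfl⟩
  rw [← hJ] at hj ⊢
  obtain ⟨σ, hσ⟩ : ∃ σ : ℂ, σ = τ / (p * J) := ⟨_, rfl⟩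
  have hσ0 : σ ≠ 0 := by rw [hσ]; exact div_ne_zero hτ0 (mul_ne_zero hp0 hj)
  have hσim : 0 < σ.im := by
    have h1 : -1 / σ = ((-(p * c) : ℝ) : ℂ) + ((p ^ 2 : ℝ) : ℂ) * (-1 / τ) := by
      rw [hσ]
      field_simp
      rw [hJ]
      push_cast
      ring
    have h2 : 0 < (-1 / σ).im := by
      rw [h1, add_im, ofReal_im, zero_add, im_ofReal_mul]
      have : (0 : ℝ) < p := by exact_mod_cast (Fact.out : p.Prime).pos
      exact mul_pos (by positivity) (im_neg_one_div_pos hτ)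
    have h3 := im_neg_one_div_pos h2
    rwa [show -1 / (-1 / σ) = σ by field_simp] at h3
  have hγ : (a * τ + b) / J = σ + b / p := by
    rw [hσ]
    field_simp
    rw [hJ]
    linear_combination τ * hdetC
  have hbe : (p : ℤ) ∣ b * (4 * A * C - B ^ 2) * e + 1 :=
    ⟨a, by rw [he] at hdet; linear_combination -hdet⟩
  set S : ℂ := ((Real.sqrt (4 * A * C - B ^ 2) : ℝ) : ℂ) with hS
  have hS0 : S ≠ 0 := by
    have : (0 : ℝ) < 4 * A * C - B ^ 2 := by exact_mod_cast hΔ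
    rw [hS]
    exact_mod_cast (Real.sqrt_pos.2 this).ne'
  have step1 : p * binaryTheta A B C (α / J) (β / J) ((a * τ + b) / J) =
      ∑ k : Fin p × Fin p, cexp (2 * Real.pi * Complex.I * (e * (C * (k.1 : ℕ) ^ 2
        - B * (k.1 : ℕ) * (k.2 : ℕ) + A * (k.2 : ℕ) ^ 2) / p)) *
        binaryTheta A B C (α / J + (k.1 : ℕ) / p) (β / J + (k.2 : ℕ) / p) σ := by
    simp only [binaryTheta]
    simp_rw [← tsum_mul_left]
    rw [← Summable.tsum_finsetSum fun k _ ↦ (summable_binaryTheta hA hΔ hσim _ _).mul_left _]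
    refine tsum_congr fun x ↦ ?_
    have h := sum_cexp_binaryForm hp2 hAp hs hbe x.1 x.2
    calc _ = (p * cexp (2 * Real.pi * Complex.I *
            (b * (A * x.1 ^ 2 + B * x.1 * x.2 + C * x.2 ^ 2) / p))) *
          cexp (2 * Real.pi * Complex.I * (σ * (A * x.1 ^ 2 + B * x.1 * x.2 + C * x.2 ^ 2)
            + α / J * x.1 + β / J * x.2)) := by
          rw [mul_assoc (p : ℂ), ← Complex.exp_add, hγ]
          congr 2
          ring
      _ = _ := by
          rw [← h, Finset.sum_mul]
          refine Finset.sum_congr rfl fun k _ ↦ ?_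
          rw [← Complex.exp_add, ← Complex.exp_add]
          congr 1
          ring
  have step2 (k : Fin p × Fin p) : cexp (2 * Real.pi * Complex.I * (e * (C * (k.1 : ℕ) ^ 2
        - B * (k.1 : ℕ) * (k.2 : ℕ) + A * (k.2 : ℕ) ^ 2) / p)) *
        binaryTheta A B C (α / J + (k.1 : ℕ) / p) (β / J + (k.2 : ℕ) / p) σ =
      Complex.I / (S * σ) * ∑' m : ℤ × ℤ, cexp (2 * Real.pi * Complex.I *
        (-(C * (((m.1 * p + (k.1 : ℕ) : ℤ) : ℂ) + α) ^ 2
          - B * (((m.1 * p + (k.1 : ℕ) : ℤ) : ℂ) + α) * (((m.2 * p + (k.2 : ℕ) : ℤ) : ℂ) + β)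
          + A * (((m.2 * p + (k.2 : ℕ) : ℤ) : ℂ) + β) ^ 2) / ((4 * A * C - B ^ 2) * τ))) := by
    rw [binaryTheta_poisson hA hΔ hσim, mul_left_comm, ← tsum_mul_left]
    congr 1
    refine tsum_congr fun m ↦ ?_
    rw [← Complex.exp_add, ← mul_add]
    refine cexp_two_pi_mul_I_eq (-(e * (C * (p * m.1 ^ 2 + 2 * m.1 * (k.1 : ℕ))
      - B * (p * m.1 * m.2 + m.1 * (k.2 : ℕ) + m.2 * (k.1 : ℕ))
      + A * (p * m.2 ^ 2 + 2 * m.2 * (k.2 : ℕ))))) ?_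
    rw [← hE, hσ, ← sub_eq_zero]
    push_cast
    have hJ' : J = E * e * τ + p := by rw [hJ, hcE]
    rw [show (0 : ℂ) = (1 / (E * τ) - p / (J * E * τ)) *
      (C * α ^ 2 - B * α * β + A * β ^ 2) by rw [hiso, mul_zero]]
    field_simp
    rw [hJ']
    ring
  have step3 := binaryTheta_poisson hA hΔ hτ α β
  rw [← hS, tsum_int_prod_eq_sum_residues p (summable_binaryTheta_dual hA hΔ hτ α β)] at step3
  simp_rw [step2] at step1
  rw [← Finset.mul_sum] at step1
  have h4 : Complex.I / (S * σ) = p * J * (Complex.I / (S * τ)) := by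
    rw [hσ]
    field_simp
  rw [h4, mul_assoc, ← step3, mul_assoc] at step1
  exact mul_left_cancel₀ hp0 step1

lemma binaryTheta_add_intCast (A B C n : ℤ) (α β τ : ℂ) :
    binaryTheta A B C α β (τ + n) = binaryTheta A B C α β τ := by
  refine tsum_congr fun x ↦ ?_
  refine cexp_two_pi_mul_I_eq (n * (A * x.1 ^ 2 + B * x.1 * x.2 + C * x.2 ^ 2)) ?_
  push_cast
  ring

theorem binaryTheta_transform {A B C : ℤ} (hA : 0 < A) (hΔ : 0 < 4 * A * C - B ^ 2)
    {α β τ : ℂ} (hτ : 0 < τ.im) (hiso : C * α ^ 2 - B * α * β + A * β ^ 2 = 0) {a b c d : ℤ}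
    (hd : 4 * A * C - B ^ 2 ∣ d - 1) (hc : 4 * A * C - B ^ 2 ∣ c) (hdet : a * d - b * c = 1) :
    binaryTheta A B C (α / (c * τ + d)) (β / (c * τ + d)) ((a * τ + b) / (c * τ + d)) =
      (c * τ + d) * binaryTheta A B C α β τ := by
  have hmod : (4 * A * C - B ^ 2) % 4 = 0 ∨ (4 * A * C - B ^ 2) % 4 = 3 := by
    rw [mul_assoc]
    generalize A * C = t
    rcases Int.even_or_odd' B with ⟨m, rfl | rfl⟩ <;> ring_nf <;> omega
  rcases eq_or_ne c 0 with rfl | hc0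
  · rw [mul_zero, sub_zero] at hdet
    rcases Int.eq_one_or_neg_one_of_mul_eq_one' hdet with ⟨rfl, rfl⟩ | ⟨rfl, rfl⟩
    · have := binaryTheta_add_intCast A B C b α β τ
      simpa using this
    · have := Int.le_of_dvd (by norm_num) ((Int.dvd_neg).2 hd)
      obtain ⟨k, hk⟩ := hd
      generalize 4 * A * C - B ^ 2 = t at *
      omega
  · have hq : NeZero c.natAbs := ⟨Int.natAbs_ne_zero.2 hc0⟩
    have hu : IsUnit ((d : ℤ) : ZMod c.natAbs) := by
      refine .of_mul_eq_one ((a : ℤ) : ZMod c.natAbs) ?_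
      have h0 : ((c : ℤ) : ZMod c.natAbs) = 0 :=
        (ZMod.intCast_zmod_eq_zero_iff_dvd _ _).2 (Int.natAbs_dvd.2 dvd_rfl)
      have := congrArg (Int.cast : ℤ → ZMod c.natAbs) hdet
      push_cast at this
      rw [h0] at this
      linear_combination this
    obtain ⟨p, hpgt, hp, hpd⟩ := Nat.forall_exists_prime_gt_and_eq_mod hu (A.toNat + 2)
    have : Fact p.Prime := ⟨hp⟩
    have hdvd : c ∣ (p : ℤ) - d := by
      rw [← Int.natAbs_dvd, ← ZMod.intCast_zmod_eq_zero_iff_dvd]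
      push_cast
      rw [hpd, sub_self]
    obtain ⟨k, hk⟩ := hdvd
    have hpΔ : 4 * A * C - B ^ 2 ∣ (p : ℤ) - 1 := by
      have : (p : ℤ) - 1 = c * k + (d - 1) := by linarith
      rw [this]
      exact (hc.mul_right k).add hd
    have hs : IsSquare (-((4 * A * C - B ^ 2 : ℤ) : ZMod p)) := by
      obtain ⟨n, hn⟩ := Int.eq_ofNat_of_zero_le hΔ.le
      rw [hn] at hmod hpΔ ⊢
      have := isSquare_neg_of_prime_eq_one_mod (n := n) (p := p) (by omega) (by omega) hpΔ
      simpa using this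
    have hAp : (A : ZMod p) ≠ 0 := by
      rw [Ne, ZMod.intCast_zmod_eq_zero_iff_dvd]
      intro h
      have := Int.le_of_dvd hA h
      omega
    have hτ' : 0 < (τ - k).im := by simpa using hτ
    have hpC : (p : ℂ) = c * k + d := by
      have : (p : ℤ) = c * k + d := by linarith
      exact_mod_cast congrArg (Int.cast : ℤ → ℂ) this
    have hJ : (c : ℂ) * (τ - k) + p = c * τ + d := by rw [hpC]; ring
    have hj : (c : ℂ) * (τ - k) + p ≠ 0 := by
      rw [hJ]
      intro h
      have h1 := congrArg Complex.im h
      simp [hc0, hτ.ne'] at h1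
    have key := binaryTheta_transform_of_prime hA hΔ hτ' hiso (by omega) hAp hs (a := a)
      (b := a * k + b) hc (by linear_combination hdet + a * hk) hj
    rw [hJ] at key
    rw [← binaryTheta_add_intCast A B C k α β (τ - k), sub_add_cancel] at key
    rw [← key]
    congr 2
    push_cast
    ring

section NumberField

variable {K : Type*} [Field K] [NumberField K]

theorem discr_basisOfFractionalIdeal (I : (FractionalIdeal (𝓞 K)⁰ K)ˣ) :
    Algebra.discr ℚ (basisOfFractionalIdeal K I) =
      FractionalIdeal.absNorm I.1 ^ 2 * NumberField.discr K := by
  have e : Module.Free.ChooseBasisIndex ℤ (𝓞 K) ≃ Module.Free.ChooseBasisIndex ℤ I := by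
    refine Fintype.equivOfCardEq ?_
    rw [← Module.finrank_eq_card_basis (integralBasis K),
      Module.finrank_eq_card_basis (basisOfFractionalIdeal K I)]
  have h := Algebra.discr_of_matrix_vecMul (A := ℚ) (integralBasis K)
    ((integralBasis K).toMatrix ((basisOfFractionalIdeal K I).reindex e.symm))
  rw [Module.Basis.toMatrix_map_vecMul, ← Module.Basis.det_apply, ← sq_abs,
    det_basisOfFractionalIdeal_eq_absNorm, ← coe_discr] at h
  rw [← h, Module.Basis.coe_reindex, Algebra.discr_reindex]

/-- A nonzero fractional ideal of a quadratic field has a `ℤ`-basis of two elements whose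
discriminant is the field discriminant times the square of the norm of the ideal. -/
theorem exists_basis_fractionalIdeal_of_finrank_eq_two (hdeg : Module.finrank ℚ K = 2)
    {𝔞 : FractionalIdeal (𝓞 K)⁰ K} (h𝔞 : 𝔞 ≠ 0) :
    ∃ b : Module.Basis (Fin 2) ℤ (𝔞 : Submodule (𝓞 K) K),
      Algebra.discr ℚ (fun i ↦ (b i : K)) =
        FractionalIdeal.absNorm 𝔞 ^ 2 * NumberField.discr K := by
  let I := Units.mk0 𝔞 h𝔞
  have e : Module.Free.ChooseBasisIndex ℤ I ≃ Fin 2 := by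
    refine Fintype.equivOfCardEq ?_
    rw [← Module.finrank_eq_card_basis (basisOfFractionalIdeal K I), hdeg, Fintype.card_fin]
  refine ⟨(fractionalIdealBasis K I.1).reindex e, ?_⟩
  have h := discr_basisOfFractionalIdeal I
  rw [← Algebra.discr_reindex ℚ _ e] at h
  refine Eq.trans ?_ h
  congr 1
  ext i
  rw [Function.comp_apply, basisOfFractionalIdeal_apply]
  exact congrArg Subtype.val (Module.Basis.reindex_apply (fractionalIdealBasis K I.1) e i)

theorem exists_intCast_eq_norm_div_absNorm {𝔞 : FractionalIdeal (𝓞 K)⁰ K} (h𝔞 : 𝔞 ≠ 0)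
    {x : K} (hx : x ∈ 𝔞) :
    ∃ n : ℤ, |Algebra.norm ℚ x| = n * FractionalIdeal.absNorm 𝔞 := by
  have hle : FractionalIdeal.spanSingleton (𝓞 K)⁰ x * 𝔞⁻¹ ≤ 1 := by
    rw [← mul_inv_cancel₀ h𝔞]
    gcongr
    rwa [FractionalIdeal.spanSingleton_le_iff_mem]
  obtain ⟨J, hJ⟩ := FractionalIdeal.le_one_iff_exists_coeIdeal.1 hle
  refine ⟨Ideal.absNorm J, ?_⟩
  rw [← FractionalIdeal.absNorm_span_singleton (R := 𝓞 K), Int.cast_natCast,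
    ← FractionalIdeal.coeIdeal_absNorm (K := K), hJ, ← map_mul, mul_assoc,
    inv_mul_cancel₀ h𝔞, mul_one]

/-- The two complex embeddings of an imaginary quadratic field. -/
theorem exists_equiv_algHom_of_finrank_eq_two (hdeg : Module.finrank ℚ K = 2) {σ : K →+* ℂ}
    (himag : ∃ x : K, (σ x).im ≠ 0) :
    ∃ e : Fin 2 ≃ (K →ₐ[ℚ] ℂ), ∀ x, e 0 x = σ x ∧ e 1 x = starRingEnd ℂ (σ x) := by
  let f : Fin 2 → (K →ₐ[ℚ] ℂ) :=
    ![σ.toRatAlgHom, ((starRingEnd ℂ).comp σ).toRatAlgHom]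
  have hf : Function.Injective f := by
    obtain ⟨x, hx⟩ := himag
    have h01 : f 0 ≠ f 1 := fun h ↦ hx (Complex.conj_eq_iff_im.1 (DFunLike.congr_fun h x).symm)
    intro i j hij
    fin_cases i <;> fin_cases j <;> simp_all
  refine ⟨Equiv.ofBijective f ((Fintype.bijective_iff_injective_and_card f).2 ⟨hf, ?_⟩),
    fun x ↦ ⟨rfl, rfl⟩⟩
  rw [Fintype.card_fin, AlgHom.card, hdeg]

theorem norm_eq_normSq_of_finrank_eq_two (hdeg : Module.finrank ℚ K = 2) {σ : K →+* ℂ}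
    (himag : ∃ x : K, (σ x).im ≠ 0) (x : K) :
    (Algebra.norm ℚ x : ℝ) = Complex.normSq (σ x) := by
  obtain ⟨e, he⟩ := exists_equiv_algHom_of_finrank_eq_two hdeg himag
  have h := Algebra.norm_eq_prod_embeddings ℚ ℂ x
  rw [← Equiv.prod_comp e, Fin.prod_univ_two, (he x).1, (he x).2, Complex.mul_conj, eq_ratCast] at h
  exact_mod_cast h

/-- The norm form of a fractional ideal of an imaginary quadratic field, relative to a suitable
`ℤ`-basis, is an integral binary quadratic form of discriminant `discr K`. -/
theorem exists_basis_normForm (hdeg : Module.finrank ℚ K = 2) {σ : K →+* ℂ}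
    (himag : ∃ x : K, (σ x).im ≠ 0) {𝔞 : FractionalIdeal (𝓞 K)⁰ K} (h𝔞 : 𝔞 ≠ 0) :
    ∃ (b : Module.Basis (Fin 2) ℤ (𝔞 : Submodule (𝓞 K) K)) (A B C : ℤ),
      0 < A ∧ 0 < 4 * A * C - B ^ 2 ∧ 4 * A * C - B ^ 2 = -NumberField.discr K ∧
      (σ (b 0) * starRingEnd ℂ (σ (b 0)) = A * (FractionalIdeal.absNorm 𝔞 : ℚ)) ∧
      (σ (b 0) * starRingEnd ℂ (σ (b 1)) + σ (b 1) * starRingEnd ℂ (σ (b 0)) =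
        B * (FractionalIdeal.absNorm 𝔞 : ℚ)) ∧
      (σ (b 1) * starRingEnd ℂ (σ (b 1)) = C * (FractionalIdeal.absNorm 𝔞 : ℚ)) := by
  obtain ⟨b, hb⟩ := exists_basis_fractionalIdeal_of_finrank_eq_two hdeg h𝔞
  have hN : 0 < FractionalIdeal.absNorm 𝔞 :=
    (FractionalIdeal.absNorm_nonneg 𝔞).lt_of_ne' (FractionalIdeal.absNorm_eq_zero_iff.not.2 h𝔞)
  have hnorm_int {x : K} (hx : x ∈ 𝔞) :
      ∃ n : ℤ, Complex.normSq (σ x) = n * (FractionalIdeal.absNorm 𝔞 : ℚ) := by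
    obtain ⟨n, hn⟩ := exists_intCast_eq_norm_div_absNorm h𝔞 hx
    have h := norm_eq_normSq_of_finrank_eq_two hdeg himag x
    refine ⟨n, ?_⟩
    rw [← abs_of_nonneg (Complex.normSq_nonneg (σ x)), ← h]
    exact_mod_cast hn
  obtain ⟨A, hA⟩ := hnorm_int (b 0).2
  obtain ⟨C, hC⟩ := hnorm_int (b 1).2
  obtain ⟨S, hS⟩ := hnorm_int (b 0 + b 1).2
  rw [Submodule.coe_add, map_add] at hS
  obtain ⟨e, he⟩ := exists_equiv_algHom_of_finrank_eq_two hdeg himag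
  have hdisc := Algebra.discr_eq_det_embeddingsMatrixReindex_pow_two ℚ ℂ (fun i ↦ (b i : K)) e
  rw [hb, Matrix.det_fin_two] at hdisc
  simp only [Algebra.embeddingsMatrixReindex, Algebra.embeddingsMatrix_apply,
    Matrix.reindex_apply, Matrix.submatrix_apply, Equiv.refl_symm, Equiv.coe_refl, id_eq,
    Equiv.symm_symm, he] at hdisc
  generalize hNr : FractionalIdeal.absNorm 𝔞 = N at *
  have hb0 : σ (b 0) ≠ 0 := by
    rw [map_ne_zero, Ne, ZeroMemClass.coe_eq_zero]
    exact b.ne_zero 0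
  generalize hu : σ (b 0) = u at *
  generalize hv : σ (b 1) = v at *
  have hNR : (0 : ℝ) < N := by exact_mod_cast hN
  have hA' : u * starRingEnd ℂ u = A * N := by
    rw [Complex.mul_conj, hA]; push_cast; rfl
  have hC' : v * starRingEnd ℂ v = C * N := by
    rw [Complex.mul_conj, hC]; push_cast; rfl
  have hB' : u * starRingEnd ℂ v + v * starRingEnd ℂ u = (S - A - C : ℤ) * N := by
    have : (u + v) * starRingEnd ℂ (u + v) = S * N := by
      rw [Complex.mul_conj, hS]; push_cast; rfl
    rw [map_add] at this
    push_cast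
    linear_combination this - hA' - hC'
  have hΔ : 4 * A * C - (S - A - C) ^ 2 = -NumberField.discr K := by
    have h : (N : ℂ) ^ 2 * ((4 * A * C - (S - A - C) ^ 2 : ℤ) : ℂ) =
        (N : ℂ) ^ 2 * ((-NumberField.discr K : ℤ) : ℂ) := by
      push_cast at hdisc hB' ⊢
      simp at hdisc
      linear_combination hdisc - (4 * C * N) * hA' - (4 * u * starRingEnd ℂ u) * hC' +
        (u * starRingEnd ℂ v + v * starRingEnd ℂ u + (S - A - C) * N) * hB'
    have hN0 : (N : ℂ) ^ 2 ≠ 0 := pow_ne_zero _ (by exact_mod_cast hN.ne')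
    exact_mod_cast mul_left_cancel₀ hN0 h
  refine ⟨b, A, S - A - C, C, ?_, ?_, hΔ, ?_⟩
  · have := Complex.normSq_pos.2 hb0
    rw [hA] at this
    exact_mod_cast pos_of_mul_pos_left this hNR.le
  · refine lt_of_le_of_ne ?_ (hΔ ▸ (neg_ne_zero.2 (discr_ne_zero K)).symm)
    have hre := congrArg Complex.re hB'
    have h : 0 ≤ ((4 * A * C - (S - A - C) ^ 2 : ℤ) : ℝ) * (N : ℝ) ^ 2 := by
      rw [Complex.normSq_apply] at hA hC
      simp only [Complex.add_re, Complex.mul_re, Complex.conj_re, Complex.conj_im,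
        Complex.intCast_re, Complex.intCast_im, Complex.ratCast_re, Complex.ratCast_im] at hre
      have h1 : ((4 * A * C - (S - A - C) ^ 2 : ℤ) : ℝ) * (N : ℝ) ^ 2 =
          (2 * (u.re * v.im - u.im * v.re)) ^ 2 := by
        push_cast at hre ⊢
        linear_combination (-4 * C * N) * hA - (4 * (u.re * u.re + u.im * u.im)) * hC +
          (2 * (u.re * v.re + u.im * v.im) + (S - A - C) * N) * hre
      rw [h1]
      positivity
    exact_mod_cast nonneg_of_mul_nonneg_left h (by positivity)
  · subst hu hv
    exact ⟨hA', hB', hC'⟩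

end NumberField

theorem intrinsicTheta_eq_binaryTheta {K : Type*} [Field K] [NumberField K] {σ : K →+* ℂ}
    {𝔞 : FractionalIdeal (𝓞 K)⁰ K} (h𝔞 : 𝔞 ≠ 0)
    (b : Module.Basis (Fin 2) ℤ (𝔞 : Submodule (𝓞 K) K)) {A B C : ℤ}
    (hA : σ (b 0) * starRingEnd ℂ (σ (b 0)) = A * (FractionalIdeal.absNorm 𝔞 : ℚ))
    (hB : σ (b 0) * starRingEnd ℂ (σ (b 1)) + σ (b 1) * starRingEnd ℂ (σ (b 0)) =
      B * (FractionalIdeal.absNorm 𝔞 : ℚ))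
    (hC : σ (b 1) * starRingEnd ℂ (σ (b 1)) = C * (FractionalIdeal.absNorm 𝔞 : ℚ))
    (w : ℂ) (τ : ℍ) :
    intrinsicTheta K σ 𝔞 w τ = binaryTheta A B C (σ (b 0) * w) (σ (b 1) * w) τ := by
  have hN : ((FractionalIdeal.absNorm 𝔞 : ℚ) : ℂ) ≠ 0 :=
    Rat.cast_ne_zero.2 (FractionalIdeal.absNorm_eq_zero_iff.not.2 h𝔞)
  rw [intrinsicTheta, binaryTheta,
    ← ((finTwoArrowEquiv ℤ).symm.trans b.equivFun.symm.toEquiv).tsum_eq]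
  refine tsum_congr fun x ↦ ?_
  have hx : σ (((finTwoArrowEquiv ℤ).symm.trans b.equivFun.symm.toEquiv x :
      (𝔞 : Submodule (𝓞 K) K)) : K) = x.1 * σ (b 0) + x.2 * σ (b 1) := by
    simp [Module.Basis.equivFun_symm_apply]
  rw [hx, ← Complex.mul_conj]
  congr 2
  simp only [map_add, map_mul, map_intCast]
  field_simp
  linear_combination (τ * x.1 ^ 2 : ℂ) * hA + (τ * x.1 * x.2 : ℂ) * hB + (τ * x.2 ^ 2 : ℂ) * hC

/-- Transformation law of the intrinsic theta function under
`γ ∈ Γ₁(D)`, `D` the discriminant of the imaginary quadratic field `K`: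
`ϑ_𝔞(w/(cτ+d), γτ) = (cτ+d) ϑ_𝔞(w,τ)`. -/
theorem statement6 (K : Type*) [Field K] [NumberField K]
    (hdeg : Module.finrank ℚ K = 2)
    (σ : K →+* ℂ) (himag : ∃ x : K, (σ x).im ≠ 0)
    (𝔞 : FractionalIdeal (𝓞 K)⁰ K) (h𝔞 : 𝔞 ≠ 0)
    (γ : SL(2, ℤ))
    (ha : (γ 0 0 : ℤ) ≡ 1 [ZMOD (NumberField.discr K)])
    (hd : (γ 1 1 : ℤ) ≡ 1 [ZMOD (NumberField.discr K)])
    (hc : (γ 1 0 : ℤ) ≡ 0 [ZMOD (NumberField.discr K)])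
    (τ : ℍ) (w : ℂ) :
    intrinsicTheta K σ 𝔞 (w / ((γ 1 0 : ℂ) * (τ : ℂ) + (γ 1 1 : ℂ))) (γ • τ) =
      ((γ 1 0 : ℂ) * (τ : ℂ) + (γ 1 1 : ℂ)) * intrinsicTheta K σ 𝔞 w τ := by
  obtain ⟨b, A, B, C, hA0, hΔ, hdisc, hA, hB, hC⟩ := exists_basis_normForm hdeg himag h𝔞
  rw [intrinsicTheta_eq_binaryTheta h𝔞 b hA hB hC, intrinsicTheta_eq_binaryTheta h𝔞 b hA hB hC,
    UpperHalfPlane.coe_specialLinearGroup_apply, ← mul_div_assoc, ← mul_div_assoc]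
  have hN : ((FractionalIdeal.absNorm 𝔞 : ℚ) : ℂ) ≠ 0 :=
    Rat.cast_ne_zero.2 (FractionalIdeal.absNorm_eq_zero_iff.not.2 h𝔞)
  have hdet := γ.det_coe
  rw [Matrix.det_fin_two] at hdet
  refine binaryTheta_transform hA0 hΔ τ.im_pos ?_ ?_ ?_ hdet
  · refine mul_left_cancel₀ hN ?_
    linear_combination (-(σ (b 0) * w) ^ 2) * hC + (σ (b 0) * w * (σ (b 1) * w)) * hB -
      (σ (b 1) * w) ^ 2 * hA
  · rw [hdisc, neg_dvd]
    exact hd.symm.dvd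
  · rw [hdisc, neg_dvd]
    exact Int.modEq_zero_iff_dvd.1 hc
end

section
/- Let N ≥ 1 be an integer and q a prime number. Then the set {γ = (a b; c d) ∈ M₂(ℤ) : det γ = q, a ≡ 1 (mod N), c ≡ 0 (mod N)} is exactly the double coset Γ₁(N)·diag(1,q)·Γ₁(N) = {γ₁ (1 0; 0 q) γ₂ : γ₁, γ₂ ∈ Γ₁(N)}. -/
open Matrix

/-- `Γ₁(N)` realized as a set of 2×2 integer matrices:
`det = 1`, `a ≡ d ≡ 1 (mod N)`, `c ≡ 0 (mod N)`. -/
def Gamma1Mat (N : ℤ) : Set (Matrix (Fin 2) (Fin 2) ℤ) :=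
  {γ | γ.det = 1 ∧ γ 0 0 ≡ 1 [ZMOD N] ∧ γ 1 1 ≡ 1 [ZMOD N] ∧ γ 1 0 ≡ 0 [ZMOD N]}

theorem gamma1Mat_mul_mem {N : ℤ} {A B : Matrix (Fin 2) (Fin 2) ℤ}
    (hA : A ∈ Gamma1Mat N) (hB : B ∈ Gamma1Mat N) : A * B ∈ Gamma1Mat N := by
  obtain ⟨hA, hA00, hA11, hA10⟩ := hA
  obtain ⟨hB, hB00, hB11, hB10⟩ := hB
  refine ⟨by rw [Matrix.det_mul, hA, hB, one_mul], ?_, ?_, ?_⟩ <;>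
    rw [Matrix.mul_apply, Fin.sum_univ_two]
  · simpa using (hA00.mul hB00).add (hB10.mul_left (A 0 1))
  · simpa using (hA10.mul_right (B 0 1)).add (hA11.mul hB11)
  · simpa using (hA10.mul_right (B 0 0)).add (hB10.mul_left (A 1 1))

theorem upper_mem_gamma1Mat (N t : ℤ) : !![1, t; 0, 1] ∈ Gamma1Mat N := by
  simp [Gamma1Mat, Matrix.det_fin_two, Int.ModEq.refl]

theorem lower_mem_gamma1Mat {N c : ℤ} (hc : c ≡ 0 [ZMOD N]) :
    !![1, 0; c, 1] ∈ Gamma1Mat N := by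
  simpa [Gamma1Mat, Matrix.det_fin_two, Int.ModEq.refl] using hc

theorem exists_gamma1Mat_mul_of_isCoprime {N q a b c d : ℤ} (hdet : a * d - b * c = q)
    (ha : a ≡ 1 [ZMOD N]) (hc : c ≡ 0 [ZMOD N]) (h : IsCoprime a q) :
    ∃ γ₁ ∈ Gamma1Mat N, ∃ γ₂ ∈ Gamma1Mat N,
      !![a, b; c, d] = γ₁ * !![1, 0; 0, q] * γ₂ := by
  obtain ⟨u, v, huv⟩ := h
  have hdet₂ : a * (u + v * d) - b * (v * c) = 1 := by
    linear_combination huv + v * hdet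
  have hvc : v * c ≡ 0 [ZMOD N] := by simpa using hc.mul_left v
  have hd₂ : u + v * d ≡ 1 [ZMOD N] := by
    have h₁ := (ha.symm.mul_right (u + v * d)).sub (hvc.symm.mul_left b)
    rw [hdet₂] at h₁
    simpa using h₁
  refine ⟨!![1, 0; u * c, 1], lower_mem_gamma1Mat (by simpa using hc.mul_left u),
    !![a, b; v * c, u + v * d],
    ⟨by rw [Matrix.det_fin_two_of, hdet₂], ha, hd₂, hvc⟩, ?_⟩
  ext i j
  fin_cases i <;> fin_cases j <;> simp
  · linear_combination -c * huv
  · linear_combination -d * huv + u * hdet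

theorem exists_gamma1Mat_mul_of_not_dvd {N q a b c d : ℤ} (hq : Prime q)
    (hdet : a * d - b * c = q) (ha : a ≡ 1 [ZMOD N]) (hc : c ≡ 0 [ZMOD N])
    (h : ¬ (q ∣ a ∧ q ∣ c)) :
    ∃ γ₁ ∈ Gamma1Mat N, ∃ γ₂ ∈ Gamma1Mat N,
      !![a, b; c, d] = γ₁ * !![1, 0; 0, q] * γ₂ := by
  by_cases hqa : q ∣ a
  · have hac : IsCoprime (a + c) q :=
      ((hq.coprime_iff_not_dvd).2 fun hac ↦ h ⟨hqa, (dvd_add_right hqa).1 hac⟩).symm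
    obtain ⟨γ₁, h₁, γ₂, h₂, hγ⟩ := exists_gamma1Mat_mul_of_isCoprime (b := b + d) (d := d)
      (by linear_combination hdet) (by simpa using ha.add hc) hc hac
    refine ⟨!![1, -1; 0, 1] * γ₁, gamma1Mat_mul_mem (upper_mem_gamma1Mat N _) h₁, γ₂, h₂, ?_⟩
    rw [Matrix.mul_assoc, Matrix.mul_assoc, ← Matrix.mul_assoc γ₁, ← hγ]
    simp
  · exact exists_gamma1Mat_mul_of_isCoprime hdet ha hc ((hq.coprime_iff_not_dvd).2 hqa).symm

theorem exists_gamma1Mat_mul {N q a b c d : ℤ} (hq : Prime q)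
    (hdet : a * d - b * c = q) (ha : a ≡ 1 [ZMOD N]) (hc : c ≡ 0 [ZMOD N]) :
    ∃ γ₁ ∈ Gamma1Mat N, ∃ γ₂ ∈ Gamma1Mat N,
      !![a, b; c, d] = γ₁ * !![1, 0; 0, q] * γ₂ := by
  by_cases h : q ∣ a ∧ q ∣ c
  · obtain ⟨hqa, hqc⟩ := h
    have hqN : ¬ q ∣ N := fun hqN ↦
      hq.not_dvd_one ((dvd_sub_right hqa).1 (hqN.trans ha.symm.dvd))
    have hnot : ¬ (q ∣ a + b * N ∧ q ∣ c + d * N) := by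
      rintro ⟨hb, hd⟩
      obtain ⟨b', rfl⟩ := (hq.dvd_or_dvd ((dvd_add_right hqa).1 hb)).resolve_right hqN
      obtain ⟨d', rfl⟩ := (hq.dvd_or_dvd ((dvd_add_right hqc).1 hd)).resolve_right hqN
      have h₁ : a * d' - b' * c = 1 := mul_left_cancel₀ hq.ne_zero (by linear_combination hdet)
      exact hq.not_dvd_one (h₁ ▸ dvd_sub (hqa.mul_right d') (hqc.mul_left b'))
    obtain ⟨γ₁, h₁, γ₂, h₂, hγ⟩ := exists_gamma1Mat_mul_of_not_dvd (N := N) (b := b) (d := d)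
      hq (by linear_combination hdet) (by simpa using ha) (by simpa using hc) hnot
    refine ⟨γ₁, h₁, γ₂ * !![1, 0; -N, 1],
      gamma1Mat_mul_mem h₂ (lower_mem_gamma1Mat (by simp [Int.ModEq])), ?_⟩
    rw [← Matrix.mul_assoc, ← hγ]
    simp
  · exact exists_gamma1Mat_mul_of_not_dvd hq hdet ha hc h

/-- For `N ≥ 1` and `q` prime, the set of integer matrices with
determinant `q`, `a ≡ 1 (mod N)` and `c ≡ 0 (mod N)` is exactly the double coset
`Γ₁(N)·diag(1,q)·Γ₁(N)`. -/
theorem statement7 (N : ℤ) (hN : 1 ≤ N) (q : ℕ) (hq : q.Prime) :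
    {γ : Matrix (Fin 2) (Fin 2) ℤ |
        γ.det = (q : ℤ) ∧ γ 0 0 ≡ 1 [ZMOD N] ∧ γ 1 0 ≡ 0 [ZMOD N]} =
      {γ : Matrix (Fin 2) (Fin 2) ℤ |
        ∃ γ₁ ∈ Gamma1Mat N, ∃ γ₂ ∈ Gamma1Mat N, γ = γ₁ * !![1, 0; 0, (q : ℤ)] * γ₂} := by
  ext γ
  constructor
  · rintro ⟨hdet, ha, hc⟩
    have h := exists_gamma1Mat_mul (Nat.prime_iff_prime_int.1 hq)
      ((Matrix.det_fin_two γ).symm.trans hdet) ha hc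
    rwa [← Matrix.eta_fin_two γ] at h
  · rintro ⟨A, ⟨hA, hA00, -, hA10⟩, B, ⟨hB, hB00, -, hB10⟩, rfl⟩
    refine ⟨by simp [Matrix.det_mul, hA, hB], ?_, ?_⟩ <;>
      simp only [Matrix.mul_apply, Fin.sum_univ_two, Matrix.of_apply, Matrix.cons_val',
        Matrix.cons_val_zero, Matrix.cons_val_one, Matrix.cons_val_fin_one, mul_one, mul_zero, add_zero, zero_add]
    · simpa using (hA00.mul hB00).add (hB10.mul_left (A 0 1 * q))
    · simpa using (hA10.mul_right (B 0 0)).add (hB10.mul_left (A 1 1 * q))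
end

section
/- Let N ≥ 1 be an integer, q a prime dividing N, and s ≥ 1. Then the set {γ = (a b; c d) ∈ M₂(ℤ) : det γ = q^s, a ≡ 1 (mod N), c ≡ 0 (mod N)} equals the double coset Γ₁(N)·diag(1,q^s)·Γ₁(N) = {γ₁ (1 0; 0 q^s) γ₂ : γ₁, γ₂ ∈ Γ₁(N)}. -/
open Matrix

/-- For `N ≥ 1`, `q` a prime dividing `N` and `s ≥ 1`, the set of
integer matrices with determinant `q^s`, `a ≡ 1 (mod N)` and `c ≡ 0 (mod N)` equals
the double coset `Γ₁(N)·diag(1,q^s)·Γ₁(N)`. -/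
theorem statement8 (N : ℤ) (hN : 1 ≤ N) (q : ℕ) (hq : q.Prime) (hqN : (q : ℤ) ∣ N)
    (s : ℕ) (hs : 1 ≤ s) :
    {γ : Matrix (Fin 2) (Fin 2) ℤ |
        γ.det = (q : ℤ) ^ s ∧ γ 0 0 ≡ 1 [ZMOD N] ∧ γ 1 0 ≡ 0 [ZMOD N]} =
      {γ : Matrix (Fin 2) (Fin 2) ℤ |
        ∃ γ₁ ∈ Gamma1Mat N, ∃ γ₂ ∈ Gamma1Mat N, γ = γ₁ * !![1, 0; 0, (q : ℤ) ^ s] * γ₂} := by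
  ext γ
  simp only [Gamma1Mat, Set.mem_ofPred_eq]
  constructor
  · rintro ⟨hdet, ha, hc⟩
    rw [det_fin_two] at hdet
    have haq : IsCoprime (γ 0 0) (q : ℤ) := by
      obtain ⟨k, hk⟩ := hqN.trans ha.dvd
      exact ⟨1, k, by linear_combination -hk⟩
    have hac : IsCoprime (γ 0 0) (γ 1 0) := by
      obtain ⟨u, v, huv⟩ := haq.pow_right (n := s)
      exact ⟨u + v * γ 1 1, -(v * γ 0 1), by linear_combination huv + v * hdet⟩
    obtain ⟨y, x, hyx⟩ := hac
    have hy : y ≡ 1 [ZMOD N] := by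
      obtain ⟨k, hk⟩ := ha.dvd
      obtain ⟨l, hl⟩ := hc.dvd
      rw [Int.modEq_iff_dvd]
      exact ⟨-(y * k) - x * l, by linear_combination -y * hk - x * hl - hyx⟩
    refine ⟨!![γ 0 0, -x; γ 1 0, y], ⟨?_, ha, hy, hc⟩,
      !![1, y * γ 0 1 + x * γ 1 1; 0, 1], ⟨by simp, rfl, rfl, rfl⟩, ?_⟩
    · rw [det_fin_two_of]
      linear_combination hyx
    · ext i j
      fin_cases i <;> fin_cases j <;> simp [Matrix.mul_apply, Fin.sum_univ_two]
      · linear_combination -γ 0 1 * hyx - x * hdet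
      · linear_combination -γ 1 1 * hyx + y * hdet
  · rintro ⟨γ₁, ⟨hdet₁, ha₁, -, hc₁⟩, γ₂, ⟨hdet₂, ha₂, -, hc₂⟩, rfl⟩
    refine ⟨by simp [hdet₁, hdet₂], ?_, ?_⟩
    · simpa [Matrix.mul_apply, Fin.sum_univ_two] using
        (ha₁.mul ha₂).add (hc₂.mul_left (γ₁ 0 1 * (q : ℤ) ^ s))
    · simpa [Matrix.mul_apply, Fin.sum_univ_two] using
        (hc₁.mul ha₂).add (hc₂.mul_left (γ₁ 1 1 * (q : ℤ) ^ s))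
end
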